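/- (Effective observation range, Proposition 1, tightness.) For all reals r_c ≥ 0, r_d ≥ 0 and every integer K ≥ 2, there exist a point a ∈ ℝ² and a sequence of positions x : ℕ → ℝ² with dist(x(j+1), x(j)) ≤ r_c for all j, such that dist(x(0), a) = r_d (device 0 lies on the boundary of the observation range, so its signal is informative) and dist(x(K−2), a) = r_d + (K−2)·r_c; moreover device K−2 still holds device 0's signal in its K−1 most recent remembered signals, since (K−2) − (K−2) ≤ 0 ≤ K−2. Hence the bound r_d' = r_d + (K−2)·r_c on the distance of devices with informative private belief is attained. -/

import Mathlib

/-- Effective observation range (Proposition 1, tightness): for all `r_c, r_d ≥ 0` and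
`K ≥ 2` there are an abnormality location `a ∈ ℝ²` and a learning sequence `x : ℕ → ℝ²`
whose consecutive devices are within communication range `r_c`, with device `0` exactly on
the boundary of the observation range (`dist (x 0) a = r_d`, so its signal is informative,
and device `K-2` still remembers it since `(K-2) - (K-2) ≤ 0 ≤ K-2`) and device `K-2` at
distance exactly `r_d + (K-2) r_c` from `a`. -/
theorem stmt_13 (r_c r_d : ℝ) (hrc : 0 ≤ r_c) (hrd : 0 ≤ r_d) (K : ℕ) (hK : 2 ≤ K) :
    ∃ (a : EuclideanSpace ℝ (Fin 2)) (x : ℕ → EuclideanSpace ℝ (Fin 2)),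
      (∀ j, dist (x (j + 1)) (x j) ≤ r_c)
      ∧ dist (x 0) a = r_d
      ∧ (K - 2) - (K - 2) ≤ 0 ∧ 0 ≤ K - 2
      ∧ dist (x (K - 2)) a = r_d + ((K - 2 : ℕ) : ℝ) * r_c := by
  refine ⟨0, fun j => EuclideanSpace.single 0 (r_d + (j : ℝ) * r_c), ?_, ?_, by omega, by omega, ?_⟩
  · intro j
    rw [EuclideanSpace.dist_single_same, Real.dist_eq]
    have h : r_d + ((j + 1 : ℕ) : ℝ) * r_c - (r_d + (j : ℝ) * r_c) = r_c := by
      push_cast; ring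
    rw [h, abs_of_nonneg hrc]
  · rw [dist_zero_right, EuclideanSpace.norm_single, Real.norm_eq_abs, abs_of_nonneg (by positivity)]
    simp
  · rw [dist_zero_right, EuclideanSpace.norm_single, Real.norm_eq_abs, abs_of_nonneg (by positivity)]
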